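/- Let k ∈ ℤ and let f : ℍ → ℂ be holomorphic with f((aτ+b)/(cτ+d)) = (cτ+d)^k·f(τ) for all (a b; c d) ∈ Γ(2) and all τ ∈ ℍ. Then the holomorphic function D_k^*f(τ) = (1/(2πi))·f′(τ) − 2k·t(τ)·f(τ) satisfies (D_k^*f)((aτ+b)/(cτ+d)) = (cτ+d)^{k+2}·(D_k^*f)(τ) for all (a b; c d) ∈ Γ(2) and all τ ∈ ℍ. -/

import Mathlib

open Complex

noncomputable section

/-- The theta constant `θ(τ) = ∑_{n ∈ ℤ} exp(πin²τ)`. -/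
def theta (τ : ℂ) : ℂ := ∑' n : ℤ, Complex.exp (Real.pi * Complex.I * (n : ℂ) ^ 2 * τ)

/-- `t(τ) = (1/(2πi)) θ'(τ)/θ(τ)`. -/
def tt (τ : ℂ) : ℂ := deriv theta τ / (2 * Real.pi * Complex.I * theta τ)

namespace SerreAux

open UpperHalfPlane ModularGroup Matrix MatrixGroups ModularForm

lemma jt_T (z τ : ℂ) : jacobiTheta₂ z (τ + 1) = jacobiTheta₂ (z + 1 / 2) τ := by
  refine tsum_congr (fun n ↦ ?_)
  simp_rw [jacobiTheta₂_term]
  obtain ⟨m, hm⟩ := (Int.even_mul_succ_self (n - 1))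
  have hm' : ((n : ℂ) - 1) * n = m + m := by
    have := congrArg (fun x : ℤ => (x : ℂ)) hm
    push_cast at this
    linear_combination this
  rw [Complex.exp_eq_exp_iff_exists_int]
  refine ⟨m, ?_⟩
  linear_combination (Real.pi * Complex.I) * hm'

lemma jt_half (τ : ℂ) : jacobiTheta₂ (1 / 2) (τ + 1) = jacobiTheta₂ 0 τ := by
  rw [jt_T, ← jacobiTheta₂_add_left 0 τ]; norm_num

lemma jt_C (τ : ℂ) : jacobiTheta₂ ((τ + 1) / 2) (τ + 1) = jacobiTheta₂ (τ / 2) τ := by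
  rw [jt_T, ← jacobiTheta₂_add_left (τ / 2) τ]; congr 1; ring

/-- eighth powers of the three theta constants -/
def A (τ : ℂ) : ℂ := jacobiTheta₂ 0 τ ^ 8
def B (τ : ℂ) : ℂ := jacobiTheta₂ (1 / 2) τ ^ 8
def C (τ : ℂ) : ℂ := Complex.exp (2 * Real.pi * Complex.I * τ) * jacobiTheta₂ (τ / 2) τ ^ 8

lemma A_T (τ : ℂ) : A (τ + 1) = B τ := by simp only [A, B, jt_T, zero_add]
lemma B_T (τ : ℂ) : B (τ + 1) = A τ := by simp only [A, B, jt_half]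
lemma C_T (τ : ℂ) : C (τ + 1) = C τ := by
  simp only [C, jt_C, mul_add, Complex.exp_add, mul_one, Complex.exp_two_pi_mul_I]

lemma root_pow (τ : ℂ) : ((-Complex.I * τ) ^ (1 / 2 : ℂ)) ^ 8 = τ ^ 4 := by
  have h : ((-Complex.I * τ) ^ (1 / 2 : ℂ)) ^ 2 = -Complex.I * τ := by
    have := Complex.cpow_nat_inv_pow (-Complex.I * τ) (n := 2) (by norm_num)
    simpa using this
  calc _ = (((-Complex.I * τ) ^ (1 / 2 : ℂ)) ^ 2) ^ 4 := by ring
    _ = (Complex.I ^ 2) ^ 2 * τ ^ 4 := by rw [h]; ring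
    _ = _ := by rw [Complex.I_sq]; ring

lemma fe8 (z τ : ℂ) (hτ : τ ≠ 0) : τ ^ 4 * jacobiTheta₂ z τ ^ 8 =
    Complex.exp (-8 * Real.pi * Complex.I * z ^ 2 / τ) * jacobiTheta₂ (z / τ) (-1 / τ) ^ 8 := by
  have h1 : ((-Complex.I * τ) ^ (1 / 2 : ℂ)) ^ 8 ≠ 0 := by
    rw [root_pow]; exact pow_ne_zero _ hτ
  rw [jacobiTheta₂_functional_equation z τ, mul_pow, mul_pow, div_pow, one_pow,
    ← Complex.exp_nat_mul, ← root_pow τ]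
  rw [show ((8 : ℕ) : ℂ) * (-Real.pi * Complex.I * z ^ 2 / τ)
    = -8 * Real.pi * Complex.I * z ^ 2 / τ by push_cast; ring]
  field_simp

lemma A_S (τ : ℂ) (hτ : τ ≠ 0) : A (-1 / τ) = τ ^ 4 * A τ := by
  have := fe8 0 τ hτ
  simpa [A] using this.symm

lemma B_S (τ : ℂ) (hτ : τ ≠ 0) : B (-1 / τ) = τ ^ 4 * C τ := by
  have := fe8 (τ / 2) τ hτ
  rw [B, C, mul_left_comm, this, ← mul_assoc, ← Complex.exp_add]
  rw [show τ / 2 / τ = 1 / 2 by field_simp]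
  rw [show 2 * Real.pi * Complex.I * τ + -8 * Real.pi * Complex.I * (τ / 2) ^ 2 / τ = 0 by
    field_simp; ring]
  simp

lemma C_S (τ : ℂ) (hτ : τ ≠ 0) : C (-1 / τ) = τ ^ 4 * B τ := by
  have := B_S (-1 / τ) (by simp [hτ])
  rw [show -1 / (-1 / τ) = τ by field_simp] at this
  rw [this]
  field_simp

/-- The theta constants indexed by vectors mod 2. -/
def F (v : Fin 2 → ZMod 2) (τ : ℍ) : ℂ :=
  if v 0 = 0 then (if v 1 = 0 then 0 else C τ) else (if v 1 = 0 then B τ else A τ)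

def red (γ : SL(2, ℤ)) : Matrix (Fin 2) (Fin 2) (ZMod 2) :=
  (Int.castRingHom (ZMod 2)).mapMatrix (γ : Matrix (Fin 2) (Fin 2) ℤ)

lemma red_apply (γ : SL(2, ℤ)) (i j : Fin 2) :
    red γ i j = (((γ : Matrix (Fin 2) (Fin 2) ℤ) i j : ℤ) : ZMod 2) := rfl

lemma red_one : red 1 = 1 := by simp [red]

lemma red_mul (x y : SL(2, ℤ)) : red (x * y) = red x * red y := by
  have h : ((x * y : SL(2, ℤ)) : Matrix (Fin 2) (Fin 2) ℤ)
      = (x : Matrix (Fin 2) (Fin 2) ℤ) * (y : Matrix (Fin 2) (Fin 2) ℤ) := rfl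
  exact (congrArg (Int.castRingHom (ZMod 2)).mapMatrix h).trans (map_mul _ _ _)

lemma red_inv_mul (x : SL(2, ℤ)) : red x⁻¹ * red x = 1 := by
  rw [← red_mul, inv_mul_cancel, red_one]

lemma F_S (v : Fin 2 → ZMod 2) : F v ∣[(4 : ℤ)] S = F (v ᵥ* (red S)) := by
  ext τ
  have h0 : (τ : ℂ) ≠ 0 := τ.ne_zero
  have e : ((S • τ : ℍ) : ℂ) = -1 / τ := by
    rw [UpperHalfPlane.modular_S_smul]; simp [neg_div, inv_neg]
  have c0 : (v ᵥ* (red S)) 0 = v 1 := by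
    simp [red_apply, coe_S, Matrix.vecMul, dotProduct, Fin.sum_univ_two]
  have c1 : (v ᵥ* (red S)) 1 = v 0 := by
    simp [red_apply, coe_S, Matrix.vecMul, dotProduct, Fin.sum_univ_two]
  rw [SL_slash_apply, denom_S]
  simp only [F, c0, c1, e]
  split_ifs
  · simp
  · rw [C_S _ h0]; field_simp
  · rw [B_S _ h0]; field_simp
  · rw [A_S _ h0]; field_simp

lemma F_T (v : Fin 2 → ZMod 2) : F v ∣[(4 : ℤ)] T = F (v ᵥ* (red T)) := by
  ext τ
  have e : ((T • τ : ℍ) : ℂ) = τ + 1 := by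
    rw [UpperHalfPlane.modular_T_smul]; simp [add_comm]
  have c0 : (v ᵥ* (red T)) 0 = v 0 := by
    simp [red_apply, coe_T, Matrix.vecMul, dotProduct, Fin.sum_univ_two]
  have c1 : (v ᵥ* (red T)) 1 = v 0 + v 1 := by
    simp [red_apply, coe_T, Matrix.vecMul, dotProduct, Fin.sum_univ_two]
  have hd : denom T τ = 1 := by rw [denom_apply]; simp [coe_T]
  rw [SL_slash_apply, hd]
  simp only [F, c0, c1, e, A_T, B_T, C_T]
  have key : ∀ x y : ZMod 2, ¬ x = 0 → (x + y = 0 ↔ ¬ y = 0) := by decide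
  by_cases h0 : v 0 = 0
  · simp [h0]
  · by_cases h1 : v 1 = 0 <;> simp [h0, h1, key]

lemma F_slash (γ : SL(2, ℤ)) : ∀ v, F v ∣[(4 : ℤ)] γ = F (v ᵥ* (red γ)) := by
  have hγ : γ ∈ Subgroup.closure {S, T} := by simp [SpecialLinearGroup.SL2Z_generators]
  induction hγ using Subgroup.closure_induction with
  | mem x hx =>
    rcases hx with rfl | rfl
    · exact F_S
    · exact F_T
  | one => intro v; simp [red_one]
  | mul x y _ _ hx hy =>
    intro v
    rw [SlashAction.slash_mul, hx, hy, Matrix.vecMul_vecMul, red_mul]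
  | inv x _ hx =>
    intro v
    have h := hx (v ᵥ* (red x⁻¹))
    have h2 : (v ᵥ* (red x⁻¹)) ᵥ* (red x) = v := by
      rw [Matrix.vecMul_vecMul, red_inv_mul, Matrix.vecMul_one]
    rw [h2] at h
    rw [← h, ← SlashAction.slash_mul]
    simp

lemma q_lt {y : ℝ} (hy0 : 0 < y) (hy : 3 ≤ 4 * y ^ 2) : Real.exp (-Real.pi * y) < 1 / 3 := by
  have h1 : (0.85 : ℝ) < y := by nlinarith
  have h2 : 2.5 < Real.pi * y := by nlinarith [Real.pi_gt_three]
  have h3 := Real.add_one_le_exp (Real.pi * y)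
  rw [neg_mul, Real.exp_neg, inv_lt_comm₀ (Real.exp_pos _) (by norm_num)]
  norm_num
  linarith

lemma A_ne {τ : ℂ} (h0 : 0 < τ.im) (h : 3 ≤ 4 * τ.im ^ 2) : A τ ≠ 0 := by
  refine pow_ne_zero _ fun h1 => ?_
  have h2 := norm_jacobiTheta_sub_one_le h0
  rw [jacobiTheta_eq_jacobiTheta₂, h1] at h2
  have h3 := q_lt h0 h
  have h4 : 0 < 1 - Real.exp (-Real.pi * τ.im) := by linarith
  rw [div_mul_eq_mul_div, le_div_iff₀ h4] at h2
  simp at h2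
  simp at h3
  linarith

lemma B_ne {τ : ℂ} (h0 : 0 < τ.im) (h : 3 ≤ 4 * τ.im ^ 2) : B τ ≠ 0 := by
  rw [← A_T]; apply A_ne <;> simpa

lemma C_ne {τ : ℂ} (h0 : 0 < τ.im) (h : 3 ≤ 4 * τ.im ^ 2) : C τ ≠ 0 := by
  refine mul_ne_zero (Complex.exp_ne_zero _) (pow_ne_zero _ fun h1 => ?_)
  have hs := hasSum_jacobiTheta₂_term (τ / 2) h0
  have hs2 := hs.nat_add_neg_add_one
  rw [h1] at hs2
  have e : ∀ n : ℕ, jacobiTheta₂_term n (τ / 2) τ + jacobiTheta₂_term (-(n + 1)) (τ / 2) τ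
      = 2 * Complex.exp (Real.pi * Complex.I * (n * (n + 1)) * τ) := by
    intro n
    rw [two_mul]
    simp only [jacobiTheta₂_term]
    push_cast
    congr 2 <;> ring
  simp_rw [e] at hs2
  have hs3 := hs2.div_const 2
  simp only [mul_div_cancel_left₀ _ (two_ne_zero' ℂ), zero_div] at hs3
  have hs4 := (hasSum_nat_add_iff' 1).2 hs3
  simp only [Finset.sum_range_one, Nat.cast_zero, zero_mul, mul_zero, Complex.exp_zero,
    zero_sub] at hs4
  set q := Real.exp (-Real.pi * τ.im) with hq
  have hq3 : q < 1 / 3 := q_lt h0 h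
  have hq0 : 0 < q := Real.exp_pos _
  have hb : ∀ n : ℕ, ‖Complex.exp (Real.pi * Complex.I * (((n + 1 : ℕ) : ℂ) * ((n + 1 : ℕ) + 1)) * τ)‖
      ≤ q ^ (n + 1) := by
    intro n
    rw [Complex.norm_exp, hq, ← Real.exp_nat_mul, Real.exp_le_exp]
    have : (Real.pi * Complex.I * (((n + 1 : ℕ) : ℂ) * ((n + 1 : ℕ) + 1)) * τ).re
        = - (Real.pi * τ.im * (((n + 1 : ℕ) : ℝ) * ((n + 1 : ℕ) + 1))) := by
      rw [show (Real.pi * Complex.I * (((n + 1 : ℕ) : ℂ) * ((n + 1 : ℕ) + 1)) * τ)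
        = ((Real.pi * (((n + 1 : ℕ) : ℝ) * ((n + 1 : ℕ) + 1)) : ℝ) : ℂ) * (τ * Complex.I) by
          push_cast; ring, Complex.re_ofReal_mul, Complex.mul_I_re]
      ring
    rw [this]
    have hp : 0 < Real.pi * τ.im := mul_pos Real.pi_pos h0
    push_cast
    have hn : (0 : ℝ) ≤ n := n.cast_nonneg
    nlinarith [mul_nonneg hp.le hn, mul_nonneg (mul_nonneg hp.le hn) hn]
  have sg : HasSum (fun n : ℕ => q ^ (n + 1)) (q / (1 - q)) := by
    simp_rw [pow_succ', div_eq_mul_inv]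
    exact (hasSum_geometric_of_lt_one hq0.le (by linarith)).mul_left q
  have := hs4.norm_le_of_bounded sg hb
  rw [le_div_iff₀ (by linarith)] at this
  simp at this
  linarith

lemma F_ne_fd (v : Fin 2 → ZMod 2) (hv : v ≠ 0) (τ : ℍ) (h : 3 ≤ 4 * τ.im ^ 2) : F v τ ≠ 0 := by
  have h0 : 0 < (τ : ℂ).im := τ.2
  have h' : 3 ≤ 4 * (τ : ℂ).im ^ 2 := h
  unfold F
  split_ifs with a b b
  · exact absurd (by ext i; fin_cases i <;> simp [a, b]) hv
  · exact C_ne h0 h'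
  · exact B_ne h0 h'
  · exact A_ne h0 h'

lemma theta_eq : theta = jacobiTheta := rfl

lemma F_one (τ : ℍ) : F ![1, 1] τ = theta τ ^ 8 := by
  rw [theta_eq, jacobiTheta_eq_jacobiTheta₂]; simp [F, A]

lemma theta_ne {τ : ℂ} (hτ : 0 < τ.im) : theta τ ≠ 0 := by
  intro h
  obtain ⟨γ, hγ⟩ := exists_smul_mem_fd ⟨τ, hτ⟩
  have h3 := three_le_four_mul_im_sq_of_mem_fd hγ
  have hv : (![1, 1] : Fin 2 → ZMod 2) ᵥ* (red γ⁻¹) ≠ 0 := by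
    intro h0
    have h2 : ((![1, 1] : Fin 2 → ZMod 2) ᵥ* (red γ⁻¹)) ᵥ* (red γ) = ![1, 1] := by
      rw [Matrix.vecMul_vecMul, red_inv_mul, Matrix.vecMul_one]
    rw [h0, Matrix.zero_vecMul] at h2
    have := congrFun h2 0
    simp at this
  refine F_ne_fd _ hv _ h3 ?_
  rw [← F_slash, SL_slash_apply, inv_smul_smul, F_one]
  simp [h]

lemma theta_mod (a b c d : ℤ) (hdet : a * d - b * c = 1)
    (ha : a % 2 = 1) (hd : d % 2 = 1) (hb : b % 2 = 0) (hc : c % 2 = 0) (τ : ℂ) (hτ : 0 < τ.im) :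
    0 < (((a : ℂ) * τ + b) / ((c : ℂ) * τ + d)).im ∧ (c : ℂ) * τ + d ≠ 0 ∧
    theta (((a : ℂ) * τ + b) / ((c : ℂ) * τ + d)) ^ 8
      = ((c : ℂ) * τ + d) ^ (4 : ℤ) * theta τ ^ 8 := by
  let γ : SL(2, ℤ) := ⟨!![a, b; c, d], by rw [Matrix.det_fin_two_of]; exact hdet⟩
  let z : ℍ := ⟨τ, hτ⟩
  have hz : (z : ℂ) = τ := rfl
  have e : ((γ • z : ℍ) : ℂ) = ((a : ℂ) * τ + b) / ((c : ℂ) * τ + d) := by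
    rw [UpperHalfPlane.specialLinearGroup_apply]; simp [γ, hz]
  have ed : denom γ z = (c : ℂ) * τ + d := by rw [denom_apply]; simp [γ, hz]
  have hr : (red γ) = 1 := by
    have z1 : ∀ n : ℤ, n % 2 = 1 → (n : ZMod 2) = 1 := fun n hn => by
      have := (ZMod.intCast_eq_intCast_iff_dvd_sub 1 n 2).2 (by omega)
      simpa using this.symm
    have z0 : ∀ n : ℤ, n % 2 = 0 → (n : ZMod 2) = 0 := fun n hn => by
      rw [ZMod.intCast_zmod_eq_zero_iff_dvd]; omega
    ext i j
    rw [red_apply]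
    fin_cases i <;> fin_cases j
    · exact z1 a ha
    · exact z0 b hb
    · exact z0 c hc
    · exact z1 d hd
  have hne : (c : ℂ) * τ + d ≠ 0 := by rw [← ed]; exact denom_ne_zero _ _
  refine ⟨by rw [← e]; exact (γ • z).2, hne, ?_⟩
  have h := congrFun (F_slash γ ![1, 1]) z
  rw [SL_slash_apply, hr, Matrix.vecMul_one, F_one, F_one, e, ed, hz] at h
  rw [← h, mul_left_comm, ← zpow_add₀ hne]
  simp

lemma deriv_mod (m : ℤ) (h : ℂ → ℂ) (hh : ∀ τ : ℂ, 0 < τ.im → DifferentiableAt ℂ h τ)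
    (a b c d : ℂ) (hdet : a * d - b * c = 1) 
    (hi : ∀ τ : ℂ, 0 < τ.im → 0 < ((a * τ + b) / (c * τ + d)).im ∧ c * τ + d ≠ 0)
    (hm : ∀ τ : ℂ, 0 < τ.im → h ((a * τ + b) / (c * τ + d)) = (c * τ + d) ^ m * h τ)
    (τ : ℂ) (hτ : 0 < τ.im) :
    deriv h ((a * τ + b) / (c * τ + d)) = (c * τ + d) ^ (m + 1) * (m * c * h τ)
      + (c * τ + d) ^ (m + 2) * deriv h τ := by
  obtain ⟨h1, h2⟩ := hi τ hτ
  have dl : HasDerivAt (fun z : ℂ => c * z + d) c τ := by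
    simpa using ((hasDerivAt_id τ).const_mul c).add_const d
  have dn : HasDerivAt (fun z : ℂ => a * z + b) a τ := by
    simpa using ((hasDerivAt_id τ).const_mul a).add_const b
  have L := (hh _ h1).hasDerivAt.comp τ (dn.div dl h2)
  have R := ((hasDerivAt_zpow m _ (Or.inl h2)).comp τ dl).mul (hh τ hτ).hasDerivAt
  have ev : (fun z => (c * z + d) ^ m * h z) =ᶠ[nhds τ] fun z => h ((a * z + b) / (c * z + d)) := by
    filter_upwards [(isOpen_lt continuous_const Complex.continuous_im).mem_nhds hτ] with z hz
    exact (hm z hz).symm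
  have := (L.congr_of_eventuallyEq ev).unique R
  have e : (a * (c * τ + d) - (a * τ + b) * c) = 1 := by linear_combination hdet
  rw [e] at this
  simp only [Function.comp] at this
  have e1 : (c * τ + d) ^ (m - 1) = (c * τ + d) ^ m / (c * τ + d) := zpow_sub_one₀ h2 m
  have e2 : (c * τ + d) ^ (m + 1) = (c * τ + d) ^ m * (c * τ + d) := zpow_add_one₀ h2 m
  have e3 : (c * τ + d) ^ (m + 2) = (c * τ + d) ^ m * (c * τ + d) ^ 2 := by
    rw [zpow_add₀ h2]; norm_cast
  rw [e1] at this
  rw [e2, e3]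
  generalize (a * τ + b) / (c * τ + d) = w at *
  generalize (c * τ + d) ^ m = u at *
  generalize c * τ + d = j at *
  field_simp at this
  linear_combination this

end SerreAux

/-- If `f` is holomorphic on `ℍ` and transforms with weight `k` under `Γ(2)`, then
`D_k^* f = (1/(2πi)) f' - 2k t f` transforms with weight `k + 2` under `Γ(2)`. -/
theorem serre_type_derivative_raises_weight
    (k : ℤ) (f : ℂ → ℂ)
    (hf_holo : ∀ τ : ℂ, 0 < τ.im → DifferentiableAt ℂ f τ)
    (hf_mod : ∀ a b c d : ℤ, a * d - b * c = 1 →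
      a % 2 = 1 → d % 2 = 1 → b % 2 = 0 → c % 2 = 0 →
      ∀ τ : ℂ, 0 < τ.im →
        f (((a : ℂ) * τ + b) / ((c : ℂ) * τ + d)) = ((c : ℂ) * τ + d) ^ k * f τ)
    (g : ℂ → ℂ)
    (hg : ∀ τ : ℂ, g τ = deriv f τ / (2 * Real.pi * Complex.I) - 2 * k * tt τ * f τ) :
    ∀ a b c d : ℤ, a * d - b * c = 1 →
      a % 2 = 1 → d % 2 = 1 → b % 2 = 0 → c % 2 = 0 →
      ∀ τ : ℂ, 0 < τ.im →
        g (((a : ℂ) * τ + b) / ((c : ℂ) * τ + d)) = ((c : ℂ) * τ + d) ^ (k + 2) * g τ := by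
  intro a b c d hdet ha hd hb hc τ hτ
  have hdetC : (a : ℂ) * d - b * c = 1 := by exact_mod_cast hdet
  have H := SerreAux.theta_mod a b c d hdet ha hd hb hc
  have hi := fun τ hτ => And.intro (H τ hτ).1 (H τ hτ).2.1
  have thd : ∀ τ : ℂ, 0 < τ.im → DifferentiableAt ℂ theta τ := fun τ hτ =>
    differentiableAt_jacobiTheta hτ
  have Df := SerreAux.deriv_mod k f hf_holo a b c d hdetC hi
    (hf_mod a b c d hdet ha hd hb hc) τ hτ
  have Dt := SerreAux.deriv_mod 4 (fun z => theta z ^ 8) (fun τ hτ => (thd τ hτ).pow 8) a b c d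
    hdetC hi (fun τ hτ => (H τ hτ).2.2) τ hτ
  have dp : ∀ τ : ℂ, 0 < τ.im →
      deriv (fun z => theta z ^ 8) τ = 8 * theta τ ^ 7 * deriv theta τ := fun τ hτ => by
    have := ((thd τ hτ).hasDerivAt.pow 8).deriv
    simpa using! this
  obtain ⟨h1, h2, h3⟩ := H τ hτ
  rw [dp _ h1, dp _ hτ] at Dt
  have n1 := SerreAux.theta_ne h1
  have n2 := SerreAux.theta_ne hτ
  have hfm := hf_mod a b c d hdet ha hd hb hc τ hτ
  have hpi : (Real.pi : ℂ) ≠ 0 := by exact_mod_cast Real.pi_ne_zero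
  rw [hg, hg, tt, tt, Df, hfm]
  generalize ((a : ℂ) * τ + b) / ((c : ℂ) * τ + d) = w at *
  generalize (c : ℂ) * τ + d = j at *
  have e2 : j ^ (k + 1) = j ^ k * j := zpow_add_one₀ h2 k
  have e3 : j ^ (k + 2) = j ^ k * j ^ 2 := by rw [zpow_add₀ h2]; norm_cast
  have key : deriv theta w / theta w = c * j / 2 + j ^ 2 * (deriv theta τ / theta τ) := by
    have e : deriv theta w / theta w = (8 * theta w ^ 7 * deriv theta w) / (8 * theta w ^ 8) := by
      field_simp
    rw [e, Dt, h3]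
    have e5 : j ^ ((4 : ℤ) + 1) = j ^ 5 := by norm_cast
    have e6 : j ^ ((4 : ℤ) + 2) = j ^ 6 := by norm_cast
    have e4 : j ^ (4 : ℤ) = j ^ 4 := by norm_cast
    rw [e4, e5, e6]
    push_cast
    field_simp
    ring
  have t1 : ∀ z, deriv theta z / (2 * Real.pi * Complex.I * theta z)
      = (deriv theta z / theta z) / (2 * Real.pi * Complex.I) := fun z => by
    rw [div_div, mul_comm (theta z)]
  rw [t1, t1, key, e2, e3]
  field_simp
  ring
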